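/- Suppose A ∈ ℝ^{n×n} is symmetric with nonnegative entries, has minimum node degree at least α ≥ 0, and satisfies ‖A‖₂ ≤ β_A; suppose ‖X‖_F ≤ β_X and σ is ρ-Lipschitz with σ(0) = 0. Let W^{(1)},…,W^{(L)} and W′^{(1)},…,W′^{(L)} be two sets of GCN weight matrices with ‖W^{(l)}‖₂ ≤ β̂_W, ‖W′^{(l)}‖₂ ≤ β̂_W and ‖W^{(l)} − W′^{(l)}‖₂ ≤ β̂_{ΔW} for all l. Let X^{(l)} and X′^{(l)} be the GCN embeddings computed on the same graph (A, X) with the two parameter sets. Then for every l ≥ 1, ‖X^{(l)} − X′^{(l)}‖_F ≤ l ρ^l (1 + α)^{−l} (1 + β_A)^l β̂_W^{l−1} β̂_{ΔW} β_X. -/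

import Mathlib

open Matrix BigOperators Finset

noncomputable def specNorm {m n : Type*} [Fintype m] [Fintype n] [DecidableEq n]
    (A : Matrix m n ℝ) : ℝ :=
  ‖LinearMap.toContinuousLinearMap (Matrix.toEuclideanLin A)‖

noncomputable def frobNorm {m n : Type*} [Fintype m] [Fintype n] (A : Matrix m n ℝ) : ℝ :=
  Real.sqrt (∑ i, ∑ j, (A i j) ^ 2)

noncomputable def vecNorm {ι : Type*} [Fintype ι] (v : ι → ℝ) : ℝ :=
  Real.sqrt (∑ i, (v i) ^ 2)

noncomputable def normAdj {v : Type*} [Fintype v] [DecidableEq v]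
    (A : Matrix v v ℝ) : Matrix v v ℝ :=
  Matrix.diagonal (fun i => (Real.sqrt (∑ j, (1 + A) i j))⁻¹) * (1 + A) *
    Matrix.diagonal (fun i => (Real.sqrt (∑ j, (1 + A) i j))⁻¹)

noncomputable def deltaD {v : Type*} [Fintype v] [DecidableEq v]
    (A ΔA : Matrix v v ℝ) : Matrix v v ℝ :=
  1 - Matrix.diagonal (fun i => Real.sqrt (∑ j, (1 + (A + ΔA)) i j)) *
      Matrix.diagonal (fun i => (Real.sqrt (∑ j, (1 + A) i j))⁻¹)

noncomputable def gcn {v : Type*} [Fintype v] (U : Matrix v v ℝ) (σ : ℝ → ℝ)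
    {d : ℕ → ℕ} (W : (l : ℕ) → Matrix (Fin (d l)) (Fin (d (l + 1))) ℝ)
    (X0 : Matrix v (Fin (d 0)) ℝ) : (l : ℕ) → Matrix v (Fin (d l)) ℝ
  | 0 => X0
  | l + 1 => (U * gcn U σ W X0 l * W l).map σ

noncomputable def avgPool {v p : Type*} [Fintype v] [Fintype p]
    (X : Matrix v p ℝ) : p → ℝ :=
  fun j => (∑ i, X i j) / (Fintype.card v : ℝ)

noncomputable def ensembleRep {n M : ℕ} {d : ℕ → ℕ} (A : Matrix (Fin n) (Fin n) ℝ)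
    (σ : ℝ → ℝ) (W : Fin M → (l : ℕ) → Matrix (Fin (d l)) (Fin (d (l + 1))) ℝ)
    (X : Matrix (Fin n) (Fin (d 0)) ℝ) (lam : Fin M → ℝ) (L : ℕ) : Fin (d L) → ℝ :=
  fun j => ∑ m, lam m * avgPool (gcn (normAdj A) σ (W m) X L) j

def principalSub {n : ℕ} (A : Matrix (Fin n) (Fin n) ℝ) (s : Finset (Fin n)) :
    Matrix s s ℝ :=
  A.submatrix (fun i => (i : Fin n)) (fun j => (j : Fin n))

def rowSub {n p : ℕ} (X : Matrix (Fin n) (Fin p) ℝ) (s : Finset (Fin n)) :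
    Matrix s (Fin p) ℝ :=
  X.submatrix (fun i => (i : Fin n)) id

theorem specNorm_nonneg {m n : Type*} [Fintype m] [Fintype n] [DecidableEq n]
    (A : Matrix m n ℝ) : 0 ≤ specNorm A :=
  norm_nonneg _

theorem frobNorm_nonneg {m n : Type*} [Fintype m] [Fintype n] (A : Matrix m n ℝ) :
    0 ≤ frobNorm A :=
  Real.sqrt_nonneg _

theorem frobNorm_sq {m n : Type*} [Fintype m] [Fintype n] (A : Matrix m n ℝ) :
    frobNorm A ^ 2 = ∑ i, ∑ j, (A i j) ^ 2 :=
  Real.sq_sqrt (Finset.sum_nonneg fun _ _ => Finset.sum_nonneg fun _ _ => sq_nonneg _)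

theorem frobNorm_transpose {m n : Type*} [Fintype m] [Fintype n] (A : Matrix m n ℝ) :
    frobNorm Aᵀ = frobNorm A := by
  unfold frobNorm
  rw [Finset.sum_comm]
  rfl

section FrobeniusNorm

open scoped Matrix.Norms.Frobenius

theorem frobNorm_eq_norm {m n : Type*} [Fintype m] [Fintype n] (A : Matrix m n ℝ) :
    frobNorm A = ‖A‖ := by
  rw [Matrix.frobenius_norm_def, ← Real.sqrt_eq_rpow]
  simp [frobNorm]

theorem frobNorm_add_le {m n : Type*} [Fintype m] [Fintype n] (A B : Matrix m n ℝ) :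
    frobNorm (A + B) ≤ frobNorm A + frobNorm B := by
  simpa only [frobNorm_eq_norm] using norm_add_le A B

end FrobeniusNorm

section L2OperatorNorm

open scoped Matrix.Norms.L2Operator

theorem specNorm_eq_norm {m n : Type*} [Fintype m] [Fintype n] [DecidableEq n]
    (A : Matrix m n ℝ) : specNorm A = ‖A‖ :=
  (Matrix.l2_opNorm_def A).symm

theorem specNorm_transpose {m n : Type*} [Fintype m] [Fintype n] [DecidableEq m] [DecidableEq n]
    (A : Matrix m n ℝ) : specNorm Aᵀ = specNorm A := by
  rw [specNorm_eq_norm, specNorm_eq_norm, ← Matrix.conjTranspose_eq_transpose_of_trivial,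
    Matrix.l2_opNorm_conjTranspose]

theorem frobNorm_mul_le_specNorm_mul {m n p : Type*} [Fintype m] [Fintype n] [Fintype p]
    [DecidableEq n] (A : Matrix m n ℝ) (B : Matrix n p ℝ) :
    frobNorm (A * B) ≤ specNorm A * frobNorm B := by
  refine le_of_sq_le_sq ?_ (mul_nonneg (specNorm_nonneg A) (frobNorm_nonneg B))
  rw [mul_pow, frobNorm_sq, frobNorm_sq, Finset.sum_comm, Finset.sum_comm (γ := n),
    Finset.mul_sum]
  refine Finset.sum_le_sum fun j _ => ?_
  have h := Matrix.l2_opNorm_mulVec A (WithLp.toLp 2 (B.col j))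
  have h2 := pow_le_pow_left₀ (norm_nonneg _) h 2
  rw [mul_pow, EuclideanSpace.norm_sq_eq, EuclideanSpace.norm_sq_eq, ← specNorm_eq_norm] at h2
  simpa [Matrix.mul_apply, Matrix.mulVec, dotProduct] using h2

theorem frobNorm_mul_le_mul_specNorm {m n p : Type*} [Fintype m] [Fintype n] [Fintype p]
    [DecidableEq n] [DecidableEq p] (A : Matrix m n ℝ) (B : Matrix n p ℝ) :
    frobNorm (A * B) ≤ frobNorm A * specNorm B := by
  rw [← frobNorm_transpose, Matrix.transpose_mul, ← frobNorm_transpose A, ← specNorm_transpose B,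
    mul_comm]
  exact frobNorm_mul_le_specNorm_mul _ _

theorem specNorm_normAdj_le {v : Type*} [Fintype v] [DecidableEq v] (A : Matrix v v ℝ) {α β : ℝ}
    (hα : 0 ≤ α) (hdeg : ∀ i, α ≤ ∑ j, A i j) (hA : specNorm A ≤ β) :
    specNorm (normAdj A) ≤ (1 + α)⁻¹ * (1 + β) := by
  have hα' : 0 < Real.sqrt (1 + α) := Real.sqrt_pos.mpr (by linarith)
  rw [specNorm_eq_norm] at hA ⊢
  have hD : ‖(Matrix.diagonal fun i => (Real.sqrt (∑ j, (1 + A) i j))⁻¹ : Matrix v v ℝ)‖ ≤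
      (Real.sqrt (1 + α))⁻¹ := by
    rw [Matrix.l2_opNorm_diagonal]
    refine (pi_norm_le_iff_of_nonneg (inv_nonneg.mpr hα'.le)).mpr fun i => ?_
    rw [Real.norm_of_nonneg (inv_nonneg.mpr (Real.sqrt_nonneg _))]
    refine inv_anti₀ hα' (Real.sqrt_le_sqrt ?_)
    simpa [Matrix.add_apply, Finset.sum_add_distrib, Matrix.one_apply] using hdeg i
  have hone : ‖(1 : Matrix v v ℝ)‖ ≤ 1 := by
    rw [← Matrix.diagonal_one, Matrix.l2_opNorm_diagonal]
    exact (pi_norm_le_iff_of_nonneg zero_le_one).mpr fun i => by simp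
  have hI : ‖1 + A‖ ≤ 1 + β := (norm_add_le _ _).trans (add_le_add hone hA)
  have hβ : 0 ≤ 1 + β := (norm_nonneg _).trans hI
  calc ‖normAdj A‖ ≤ (Real.sqrt (1 + α))⁻¹ * (1 + β) * (Real.sqrt (1 + α))⁻¹ := by
        refine (Matrix.l2_opNorm_mul _ _).trans (mul_le_mul ?_ hD (norm_nonneg _) (by positivity))
        exact (Matrix.l2_opNorm_mul _ _).trans
          (mul_le_mul hD hI (norm_nonneg _) (by positivity))
    _ = (Real.sqrt (1 + α) * Real.sqrt (1 + α))⁻¹ * (1 + β) := by rw [mul_inv]; ring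
    _ = (1 + α)⁻¹ * (1 + β) := by rw [Real.mul_self_sqrt (by linarith)]

end L2OperatorNorm

theorem frobNorm_mul_mul_le {m n p q : Type*} [Fintype m] [Fintype n] [Fintype p] [Fintype q]
    [DecidableEq n] [DecidableEq p] [DecidableEq q] {A : Matrix m n ℝ} {B : Matrix n p ℝ}
    {C : Matrix p q ℝ} {a b c : ℝ} (hA : specNorm A ≤ a) (hB : frobNorm B ≤ b)
    (hC : specNorm C ≤ c) : frobNorm (A * B * C) ≤ a * b * c := by
  have ha := (specNorm_nonneg A).trans hA
  have hb := (frobNorm_nonneg B).trans hB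
  refine (frobNorm_mul_le_mul_specNorm _ _).trans
    (mul_le_mul ?_ hC (specNorm_nonneg C) (mul_nonneg ha hb))
  exact (frobNorm_mul_le_specNorm_mul _ _).trans (mul_le_mul hA hB (frobNorm_nonneg B) ha)

theorem frobNorm_map_sub_map_le {m n : Type*} [Fintype m] [Fintype n] {σ : ℝ → ℝ} {ρ : ℝ}
    (hρ : 0 ≤ ρ) (hσ : ∀ a b : ℝ, |σ a - σ b| ≤ ρ * |a - b|) (A B : Matrix m n ℝ) :
    frobNorm (A.map σ - B.map σ) ≤ ρ * frobNorm (A - B) := by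
  refine le_of_sq_le_sq ?_ (mul_nonneg hρ (frobNorm_nonneg _))
  rw [mul_pow, frobNorm_sq, frobNorm_sq, Finset.mul_sum]
  refine Finset.sum_le_sum fun i _ => ?_
  rw [Finset.mul_sum]
  refine Finset.sum_le_sum fun j _ => ?_
  have h := pow_le_pow_left₀ (abs_nonneg _) (hσ (A i j) (B i j)) 2
  simpa [mul_pow, sq_abs] using h

theorem frobNorm_map_le {m n : Type*} [Fintype m] [Fintype n] {σ : ℝ → ℝ} {ρ : ℝ}
    (hρ : 0 ≤ ρ) (hσ : ∀ a b : ℝ, |σ a - σ b| ≤ ρ * |a - b|) (hσ0 : σ 0 = 0)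
    (A : Matrix m n ℝ) : frobNorm (A.map σ) ≤ ρ * frobNorm A := by
  have h := frobNorm_map_sub_map_le hρ hσ A 0
  rwa [Matrix.map_zero _ hσ0, sub_zero, sub_zero] at h

theorem frobNorm_gcn_le {v : Type*} [Fintype v] [DecidableEq v] {d : ℕ → ℕ} {U : Matrix v v ℝ}
    {X : Matrix v (Fin (d 0)) ℝ} {W : (l : ℕ) → Matrix (Fin (d l)) (Fin (d (l + 1))) ℝ}
    {σ : ℝ → ℝ} {ρ u w x : ℝ} (hρ : 0 ≤ ρ) (hσ : ∀ a b : ℝ, |σ a - σ b| ≤ ρ * |a - b|)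
    (hσ0 : σ 0 = 0) (hU : specNorm U ≤ u) (hX : frobNorm X ≤ x) :
    ∀ l : ℕ, (∀ k < l, specNorm (W k) ≤ w) → frobNorm (gcn U σ W X l) ≤ (ρ * u * w) ^ l * x := by
  intro l
  induction l with
  | zero => intro _; simpa [gcn] using hX
  | succ l ih =>
    intro hW
    have hl := ih fun k hk => hW k (by omega)
    calc frobNorm (gcn U σ W X (l + 1)) ≤ ρ * frobNorm (U * gcn U σ W X l * W l) :=
          frobNorm_map_le hρ hσ hσ0 _
      _ ≤ ρ * (u * ((ρ * u * w) ^ l * x) * w) :=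
          mul_le_mul_of_nonneg_left (frobNorm_mul_mul_le hU hl (hW l (by omega))) hρ
      _ = (ρ * u * w) ^ (l + 1) * x := by ring

theorem frobNorm_gcn_sub_gcn_le {v : Type*} [Fintype v] [DecidableEq v] {d : ℕ → ℕ}
    {U : Matrix v v ℝ} {X : Matrix v (Fin (d 0)) ℝ}
    {W W' : (l : ℕ) → Matrix (Fin (d l)) (Fin (d (l + 1))) ℝ}
    {σ : ℝ → ℝ} {ρ u w δ x : ℝ} (hρ : 0 ≤ ρ) (hσ : ∀ a b : ℝ, |σ a - σ b| ≤ ρ * |a - b|)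
    (hσ0 : σ 0 = 0) (hU : specNorm U ≤ u) (hX : frobNorm X ≤ x) :
    ∀ l : ℕ, (∀ k < l, specNorm (W k) ≤ w) → (∀ k < l, specNorm (W' k) ≤ w) →
      (∀ k < l, specNorm (W k - W' k) ≤ δ) →
      frobNorm (gcn U σ W X l - gcn U σ W' X l) ≤ l * (ρ * u) ^ l * w ^ (l - 1) * δ * x := by
  intro l
  induction l with
  | zero => intros; simp [gcn, frobNorm]
  | succ l ih =>
    intro hW hW' hδ
    have hl := ih (fun k hk => hW k (by omega)) (fun k hk => hW' k (by omega))
      fun k hk => hδ k (by omega)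
    have hl' := frobNorm_gcn_le (W := W') hρ hσ hσ0 hU hX l fun k hk => hW' k (by omega)
    have hsplit : U * gcn U σ W X l * W l - U * gcn U σ W' X l * W' l =
        U * (gcn U σ W X l - gcn U σ W' X l) * W l + U * gcn U σ W' X l * (W l - W' l) := by
      rw [Matrix.mul_sub, Matrix.sub_mul, Matrix.mul_sub]
      abel
    calc frobNorm (gcn U σ W X (l + 1) - gcn U σ W' X (l + 1))
        ≤ ρ * frobNorm (U * gcn U σ W X l * W l - U * gcn U σ W' X l * W' l) :=
          frobNorm_map_sub_map_le hρ hσ _ _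
      _ ≤ ρ * (u * (l * (ρ * u) ^ l * w ^ (l - 1) * δ * x) * w +
            u * ((ρ * u * w) ^ l * x) * δ) := by
          refine mul_le_mul_of_nonneg_left ?_ hρ
          rw [hsplit]
          exact (frobNorm_add_le _ _).trans
            (add_le_add (frobNorm_mul_mul_le hU hl (hW l (by omega)))
              (frobNorm_mul_mul_le hU hl' (hδ l (by omega))))
      _ = (l + 1 : ℕ) * (ρ * u) ^ (l + 1) * w ^ (l + 1 - 1) * δ * x := by
          cases l with
          | zero => simp; ring
          | succ l => simp only [Nat.add_sub_cancel]; push_cast; ring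

theorem frob_norm_gcn_weight_perturb_le {n : ℕ} {d : ℕ → ℕ}
    (A : Matrix (Fin n) (Fin n) ℝ) (X : Matrix (Fin n) (Fin (d 0)) ℝ)
    (W W' : (l : ℕ) → Matrix (Fin (d l)) (Fin (d (l + 1))) ℝ) (L : ℕ)
    (σ : ℝ → ℝ) (α βA βX βW βΔW ρ : ℝ)
    (hsymm : A.IsSymm) (hnonneg : ∀ i j, 0 ≤ A i j)
    (hα : 0 ≤ α) (hdeg : ∀ i, α ≤ ∑ j, A i j) (hA : specNorm A ≤ βA)
    (hX : frobNorm X ≤ βX)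
    (hW : ∀ l < L, specNorm (W l) ≤ βW) (hW' : ∀ l < L, specNorm (W' l) ≤ βW)
    (hΔW : ∀ l < L, specNorm (W l - W' l) ≤ βΔW)
    (hρ : 0 ≤ ρ) (hσ : ∀ a b : ℝ, |σ a - σ b| ≤ ρ * |a - b|) (hσ0 : σ 0 = 0) :
    ∀ l, 1 ≤ l → l ≤ L →
      frobNorm (gcn (normAdj A) σ W X l - gcn (normAdj A) σ W' X l) ≤
        (l : ℝ) * ρ ^ l * ((1 + α) ^ l)⁻¹ * (1 + βA) ^ l * βW ^ (l - 1) * βΔW * βX := by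
  intro l _ hlL
  have hU := specNorm_normAdj_le A hα hdeg hA
  have h := frobNorm_gcn_sub_gcn_le hρ hσ hσ0 hU hX l (fun k hk => hW k (by omega))
    (fun k hk => hW' k (by omega)) fun k hk => hΔW k (by omega)
  rwa [← mul_assoc ρ, mul_pow, mul_pow, inv_pow, ← mul_assoc, ← mul_assoc] at h
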